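/- arXiv:1603.02329 — 4 statements merged into one kernel-verified Lean document; each statement's English description precedes it below -/
import Mathlib

section
/- Continuous adjoint identity for lossless photoacoustic tomography: Let d ≥ 1, T > 0, and let ρ₀, c₀ : ℝ^d → ℝ be smooth with ρ₀(r) > 0 and c₀(r) > 0 for all r. Let p₀ : ℝ^d → ℝ be smooth and compactly supported, and let w, h : ℝ^d × ℝ → ℝ be smooth and compactly supported. Suppose p, ρ : ℝ^d × ℝ → ℝ and u : ℝ^d × ℝ → ℝ^d are smooth, supported in K × [0,T] in the space variable for some compact K ⊆ ℝ^d, and satisfy the forward system ∂u/∂t(r,t) = −(1/ρ₀(r)) ∇p(r,t), ∂ρ/∂t(r,t) = −ρ₀(r) ∇·u(r,t), p(r,t) = c₀(r)² ρ(r,t), with initial conditions p(r,0) = p₀(r) and u(r,0) = 0. Suppose p*, ρ* : ℝ^d × ℝ → ℝ and u* : ℝ^d × ℝ → ℝ^d are smooth, compactly supported in space uniformly for t ∈ [0,T], and satisfy the adjoint system ∂u*/∂t(r,t) = −(1/ρ₀(r)) ∇p*(r,t), ∂ρ*/∂t(r,t) = ρ₀(r) ( −∇·u*(r,t) + w(r,T−t)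 h(r,T−t) ), p*(r,t) = c₀(r)² ρ*(r,t), with initial conditions p*(r,0) = 0 and u*(r,0) = 0. Then ∫₀^T ∫_{ℝ^d} w(r,t) p(r,t) h(r,t) dr dt = ∫_{ℝ^d} p₀(r) ρ*(r,T)/ρ₀(r) dr. -/
open MeasureTheory

/-- Spatial divergence of a vector field on `ℝ^d`. -/
noncomputable def spaceDiv {d : ℕ}
    (u : EuclideanSpace ℝ (Fin d) → EuclideanSpace ℝ (Fin d))
    (r : EuclideanSpace ℝ (Fin d)) : ℝ :=
  ∑ i, fderiv ℝ u r (EuclideanSpace.single i 1) i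

lemma aux_fubini {d : ℕ} (T : ℝ) (hT : 0 < T) (D : EuclideanSpace ℝ (Fin d) × ℝ → ℝ)
    (hD : Continuous D) (K : Set (EuclideanSpace ℝ (Fin d))) (hK : IsCompact K)
    (hz : ∀ t ∈ Set.Icc (0 : ℝ) T, ∀ r ∉ K, D (r, t) = 0) :
    ∫ t in (0 : ℝ)..T, ∫ r, D (r, t) = ∫ r, ∫ t in (0 : ℝ)..T, D (r, t) := by
  apply MeasureTheory.intervalIntegral_integral_swap
  have h1 : (volume.restrict (Set.uIoc 0 T)).prod (volume : Measure (EuclideanSpace ℝ (Fin d)))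
      = ((volume : Measure ℝ).prod volume).restrict (Set.uIoc 0 T ×ˢ Set.univ) := by
    rw [← Measure.prod_restrict, Measure.restrict_univ]
  rw [h1]
  have hc : Continuous (Function.uncurry fun (t : ℝ) (r : EuclideanSpace ℝ (Fin d)) => D (r, t)) := by
    unfold Function.uncurry; fun_prop
  have h2 : IntegrableOn (Function.uncurry fun (t : ℝ) (r : EuclideanSpace ℝ (Fin d)) => D (r, t))
      (Set.Icc 0 T ×ˢ K) ((volume : Measure ℝ).prod volume) :=
    hc.continuousOn.integrableOn_compact (isCompact_Icc.prod hK)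
  refine IntegrableOn.of_forall_sdiff_eq_zero h2 ?_ ?_
  · exact measurableSet_uIoc.prod MeasurableSet.univ
  · rintro ⟨t, r⟩ ⟨⟨h3, -⟩, h4⟩
    simp only at h3
    rw [Set.uIoc_of_le hT.le] at h3
    have h5 : t ∈ Set.Icc 0 T := ⟨h3.1.le, h3.2⟩
    exact hz t h5 r (fun hr => h4 ⟨h5, hr⟩)

lemma aux_div {d : ℕ} (V : EuclideanSpace ℝ (Fin d) → EuclideanSpace ℝ (Fin d))
    (hV : ContDiff ℝ 1 V) (hs : HasCompactSupport V) : ∫ r, spaceDiv V r = 0 := by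
  have hc : ∀ v, Continuous fun x => fderiv ℝ V x v := fun v =>
    (hV.continuous_fderiv one_ne_zero).clm_apply continuous_const
  have hcs : ∀ v, HasCompactSupport fun x => fderiv ℝ V x v := fun v => hs.fderiv_apply ℝ v
  have hint : ∀ v, Integrable fun x => fderiv ℝ V x v := fun v =>
    (hc v).integrable_of_hasCompactSupport (hcs v)
  have hzero : ∀ v, ∫ x, fderiv ℝ V x v = 0 := by
    intro v
    have := integral_smul_fderiv_eq_neg_fderiv_smul_of_integrable (μ := volume)
      (f := fun _ : EuclideanSpace ℝ (Fin d) => (1 : ℝ)) (g := V) (v := v)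
      (by simp) (by simpa using hint v)
      (by simpa using hV.continuous.integrable_of_hasCompactSupport hs)
      (by intros; fun_prop) (by intro x _; exact hV.differentiable one_ne_zero x)
    simpa using this
  unfold spaceDiv
  rw [integral_finsetSum]
  · refine Finset.sum_eq_zero fun i _ => ?_
    have := (EuclideanSpace.proj (𝕜 := ℝ) i).integral_comp_comm (hint (EuclideanSpace.single i 1))
    rw [hzero] at this
    simpa using this
  · intro i _
    exact (EuclideanSpace.proj (𝕜 := ℝ) i).integrable_comp (hint (EuclideanSpace.single i 1))

lemma aux_div_smul {d : ℕ} (f : EuclideanSpace ℝ (Fin d) → ℝ)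
    (V : EuclideanSpace ℝ (Fin d) → EuclideanSpace ℝ (Fin d)) (r : EuclideanSpace ℝ (Fin d))
    (hf : DifferentiableAt ℝ f r) (hV : DifferentiableAt ℝ V r) :
    spaceDiv (fun x => f x • V x) r = f r * spaceDiv V r + inner ℝ (gradient f r) (V r) := by
  unfold spaceDiv
  rw [fderiv_fun_smul hf hV, inner_gradient_left, Finset.mul_sum]
  simp only [add_apply, _root_.smul_apply, ContinuousLinearMap.smulRight_apply,
    PiLp.add_apply, PiLp.smul_apply, smul_eq_mul, Finset.sum_add_distrib]
  congr 1
  have h1 : V r = ∑ i, V r i • EuclideanSpace.single i (1 : ℝ) := by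
    ext j; simp [Pi.single_apply]
  conv_rhs => rw [h1]
  simp [mul_comm]

lemma aux_div_sub {d : ℕ} 
    (V W : EuclideanSpace ℝ (Fin d) → EuclideanSpace ℝ (Fin d)) (r : EuclideanSpace ℝ (Fin d))
    (hV : DifferentiableAt ℝ V r) (hW : DifferentiableAt ℝ W r) :
    spaceDiv (fun x => V x - W x) r = spaceDiv V r - spaceDiv W r := by
  unfold spaceDiv
  rw [fderiv_fun_sub hV hW]
  simp

/-- Continuous adjoint identity for lossless photoacoustic tomography:
if `(p, ρ, u)` solves the forward lossless acoustic system with initial pressure `p₀`,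
and `(p*, ρ*, u*)` solves the time-reversed adjoint system with mass source
`w(r,T−t) h(r,T−t)`, then
`∫₀^T ∫ w p h dr dt = ∫ p₀(r) ρ*(r,T)/ρ₀(r) dr`. -/
theorem adjoint_identity_lossless
    (d : ℕ) (hd : 1 ≤ d) (T : ℝ) (hT : 0 < T)
    (ρ₀ c₀ : EuclideanSpace ℝ (Fin d) → ℝ)
    (hρ₀ : ContDiff ℝ (⊤ : ℕ∞) ρ₀) (hc₀ : ContDiff ℝ (⊤ : ℕ∞) c₀)
    (hρ₀pos : ∀ r, 0 < ρ₀ r) (hc₀pos : ∀ r, 0 < c₀ r)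
    (p₀ : EuclideanSpace ℝ (Fin d) → ℝ)
    (hp₀ : ContDiff ℝ (⊤ : ℕ∞) p₀) (hp₀supp : HasCompactSupport p₀)
    (w h : EuclideanSpace ℝ (Fin d) × ℝ → ℝ)
    (hw : ContDiff ℝ (⊤ : ℕ∞) w) (hwsupp : HasCompactSupport w)
    (hh : ContDiff ℝ (⊤ : ℕ∞) h) (hhsupp : HasCompactSupport h)
    -- forward fields
    (p ρ : EuclideanSpace ℝ (Fin d) × ℝ → ℝ)
    (u : EuclideanSpace ℝ (Fin d) × ℝ → EuclideanSpace ℝ (Fin d))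
    (hp : ContDiff ℝ (⊤ : ℕ∞) p) (hρ : ContDiff ℝ (⊤ : ℕ∞) ρ) (hu : ContDiff ℝ (⊤ : ℕ∞) u)
    (hsupp : ∃ K : Set (EuclideanSpace ℝ (Fin d)), IsCompact K ∧
      ∀ t ∈ Set.Icc (0 : ℝ) T, ∀ r ∉ K, p (r, t) = 0 ∧ ρ (r, t) = 0 ∧ u (r, t) = 0)
    -- forward system
    (hmom : ∀ r t, deriv (fun s => u (r, s)) t
      = -(ρ₀ r)⁻¹ • gradient (fun x => p (x, t)) r)
    (hmass : ∀ r t, deriv (fun s => ρ (r, s)) t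
      = -(ρ₀ r) * spaceDiv (fun x => u (x, t)) r)
    (hstate : ∀ r t, p (r, t) = (c₀ r) ^ 2 * ρ (r, t))
    (hpinit : ∀ r, p (r, 0) = p₀ r) (huinit : ∀ r, u (r, 0) = 0)
    -- adjoint fields
    (pa ρa : EuclideanSpace ℝ (Fin d) × ℝ → ℝ)
    (ua : EuclideanSpace ℝ (Fin d) × ℝ → EuclideanSpace ℝ (Fin d))
    (hpa : ContDiff ℝ (⊤ : ℕ∞) pa) (hρa : ContDiff ℝ (⊤ : ℕ∞) ρa) (hua : ContDiff ℝ (⊤ : ℕ∞) ua)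
    (hsuppa : ∃ K : Set (EuclideanSpace ℝ (Fin d)), IsCompact K ∧
      ∀ t ∈ Set.Icc (0 : ℝ) T, ∀ r ∉ K, pa (r, t) = 0 ∧ ρa (r, t) = 0 ∧ ua (r, t) = 0)
    -- adjoint system
    (hmoma : ∀ r t, deriv (fun s => ua (r, s)) t
      = -(ρ₀ r)⁻¹ • gradient (fun x => pa (x, t)) r)
    (hmassa : ∀ r t, deriv (fun s => ρa (r, s)) t
      = ρ₀ r * (-(spaceDiv (fun x => ua (x, t)) r) + w (r, T - t) * h (r, T - t)))
    (hstatea : ∀ r t, pa (r, t) = (c₀ r) ^ 2 * ρa (r, t))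
    (hpainit : ∀ r, pa (r, 0) = 0) (huainit : ∀ r, ua (r, 0) = 0) :
    ∫ t in (0 : ℝ)..T, ∫ r, w (r, t) * p (r, t) * h (r, t)
      = ∫ r, p₀ r * ρa (r, T) / ρ₀ r := by
  obtain ⟨K, hK, hKz⟩ := hsupp
  obtain ⟨L, hL, hLz⟩ := hsuppa
  have hne : ∀ r, ρ₀ r ≠ 0 := fun r => (hρ₀pos r).ne'
  set G : EuclideanSpace ℝ (Fin d) × ℝ → ℝ := fun z =>
    p z * ρa (z.1, T - z.2) / ρ₀ z.1 - ρ₀ z.1 * inner ℝ (u z) (ua (z.1, T - z.2)) with hG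
  have hGs : ContDiff ℝ (⊤ : ℕ∞) G := by
    have e1 : ContDiff ℝ (⊤ : ℕ∞) fun z : EuclideanSpace ℝ (Fin d) × ℝ => (z.1, T - z.2) := by
      fun_prop
    have e2 : ContDiff ℝ (⊤ : ℕ∞) fun z : EuclideanSpace ℝ (Fin d) × ℝ => ρ₀ z.1 :=
      hρ₀.comp contDiff_fst
    exact ((hp.mul (hρa.comp e1)).div e2 (fun z => hne z.1)).sub
      (e2.mul (hu.inner ℝ (hua.comp e1)))
  set D : EuclideanSpace ℝ (Fin d) × ℝ → ℝ := fun z => fderiv ℝ G z (0, 1) with hDdef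
  have hDc : Continuous D :=
    (hGs.continuous_fderiv (by simp)).clm_apply continuous_const
  have hGD : ∀ r t, HasDerivAt (fun s => G (r, s)) (D (r, t)) t := by
    intro r t
    have h1 : HasFDerivAt G (fderiv ℝ G (r, t)) (r, t) :=
      (hGs.differentiable (by simp) (r, t)).hasFDerivAt
    exact h1.comp_hasDerivAt t ((hasDerivAt_const t r).prodMk (hasDerivAt_id t))
  have slice_t : ∀ {F : Type} [NormedAddCommGroup F] [NormedSpace ℝ F]
      (f : EuclideanSpace ℝ (Fin d) × ℝ → F), ContDiff ℝ (⊤ : ℕ∞) f → ∀ r t,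
      HasDerivAt (fun s => f (r, s)) (deriv (fun s => f (r, s)) t) t := by
    intro F _ _ f hf r t
    have : Differentiable ℝ (fun s => f (r, s)) :=
      (hf.differentiable (by simp)).comp (by fun_prop)
    exact (this t).hasDerivAt
  have slice_r : ∀ {F : Type} [NormedAddCommGroup F] [NormedSpace ℝ F]
      (f : EuclideanSpace ℝ (Fin d) × ℝ → F), ContDiff ℝ (⊤ : ℕ∞) f → ∀ t,
      ContDiff ℝ 1 (fun x => f (x, t)) := by
    intro F _ _ f hf t
    exact (hf.of_le (by exact_mod_cast le_top)).comp (by fun_prop)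
  have hrev : ∀ t, HasDerivAt (fun s : ℝ => T - s) (-1) t := fun t => by
    simpa using (hasDerivAt_id t).const_sub T
  -- explicit formula for the time derivative
  have hform : ∀ r t, D (r, t) =
      (p (r, t) * spaceDiv (fun x => ua (x, T - t)) r
        + inner ℝ (gradient (fun x => p (x, t)) r) (ua (r, T - t)))
      - (pa (r, T - t) * spaceDiv (fun x => u (x, t)) r
        + inner ℝ (gradient (fun x => pa (x, T - t)) r) (u (r, t)))
      - w (r, t) * p (r, t) * h (r, t) := by
    intro r t
    have d1 := slice_t ρ hρ r t
    have d2 := (slice_t ρa hρa r (T - t)).scomp t (hrev t)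
    have d3 := slice_t u hu r t
    have d4 := (slice_t ua hua r (T - t)).scomp t (hrev t)
    rw [hmass] at d1
    rw [hmassa] at d2
    rw [hmom] at d3
    rw [hmoma] at d4
    have d5 := (((d1.const_mul (c₀ r ^ 2)).mul d2).div_const (ρ₀ r)).sub
      ((d3.inner ℝ d4).const_mul (ρ₀ r))
    have d6 := hGD r t
    have e : (fun s => G (r, s)) = _ := funext fun s => show G (r, s) =
      (c₀ r ^ 2 * ρ (r, s)) * ρa (r, T - s) / ρ₀ r
        - ρ₀ r * inner ℝ (u (r, s)) (ua (r, T - s)) by simp only [hG, hstate]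
    rw [e] at d6
    rw [d6.unique d5]
    simp only [Function.comp_apply, inner_smul_left, inner_smul_right, hstate r t,
      hstatea r (T - t), smul_eq_mul, real_inner_comm (u (r, t)), sub_sub_cancel,
      conj_trivial]
    have := hne r
    field_simp
    ring
  have hD0 : ∀ t ∈ Set.Icc (0 : ℝ) T, ∀ r ∉ K ∪ L, D (r, t) = 0 := by
    intro t ht r hr
    have ht' : T - t ∈ Set.Icc (0 : ℝ) T := ⟨by linarith [ht.2], by linarith [ht.1]⟩
    obtain ⟨a1, a2, a3⟩ := hKz t ht r (fun h => hr (Or.inl h))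
    obtain ⟨b1, b2, b3⟩ := hLz (T - t) ht' r (fun h => hr (Or.inr h))
    rw [hform, a1, a3, b1, b3]
    simp
  have hfub := aux_fubini T hT D hDc (K ∪ L) (hK.union hL) hD0
  -- the right hand side
  have hR : ∀ r, ∫ t in (0 : ℝ)..T, D (r, t) = -(p₀ r * ρa (r, T) / ρ₀ r) := by
    intro r
    rw [intervalIntegral.integral_eq_sub_of_hasDerivAt (fun t _ => hGD r t)
      ((hDc.comp (by fun_prop : Continuous fun t : ℝ => (r, t))).intervalIntegrable _ _)]
    have hz : ρa (r, 0) = 0 := by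
      have h1 := hstatea r 0
      rw [hpainit] at h1
      have := (hc₀pos r).ne'
      simpa [this] using h1.symm
    simp [hG, hz, huainit, huinit, hpinit]
  -- the left hand side
  have hLft : ∀ t ∈ Set.uIcc (0 : ℝ) T,
      ∫ r, D (r, t) = -∫ r, w (r, t) * p (r, t) * h (r, t) := by
    intro t ht
    rw [Set.uIcc_of_le hT.le] at ht
    have ht' : T - t ∈ Set.Icc (0 : ℝ) T := ⟨by linarith [ht.2], by linarith [ht.1]⟩
    set V : EuclideanSpace ℝ (Fin d) → EuclideanSpace ℝ (Fin d) := fun x =>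
      p (x, t) • ua (x, T - t) - pa (x, T - t) • u (x, t) with hV
    have s1 := slice_r p hp t
    have s2 := slice_r ua hua (T - t)
    have s3 := slice_r pa hpa (T - t)
    have s4 := slice_r u hu t
    have hVs : ContDiff ℝ 1 V := (s1.smul s2).sub (s3.smul s4)
    have hVc : HasCompactSupport V := by
      refine HasCompactSupport.intro hK fun x hx => ?_
      obtain ⟨a1, a2, a3⟩ := hKz t ht x hx
      simp [hV, a1, a3]
    have hdiv : ∀ r, spaceDiv V r = D (r, t) + w (r, t) * p (r, t) * h (r, t) := by
      intro r
      have t1 := s1.differentiable one_ne_zero r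
      have t2 := s2.differentiable one_ne_zero r
      have t3 := s3.differentiable one_ne_zero r
      have t4 := s4.differentiable one_ne_zero r
      rw [hform, hV, aux_div_sub _ _ r (t1.fun_smul t2) (t3.fun_smul t4),
        aux_div_smul _ _ r t1 t2, aux_div_smul _ _ r t3 t4]
      ring
    have h0 := aux_div V hVs hVc
    simp only [hdiv] at h0
    have sl : Continuous fun r : EuclideanSpace ℝ (Fin d) => (r, t) := by fun_prop
    rw [integral_add] at h0
    · linarith
    · refine (hDc.comp sl).integrable_of_hasCompactSupport ?_
      exact HasCompactSupport.intro (hK.union hL) fun x hx => hD0 t ht x hx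
    · refine (((hw.continuous.comp sl).mul (hp.continuous.comp sl)).mul
        (hh.continuous.comp sl)).integrable_of_hasCompactSupport ?_
      refine HasCompactSupport.intro hK fun x hx => ?_
      simp [(hKz t ht x hx).1]
  rw [intervalIntegral.integral_congr hLft] at hfub
  simp only [hR] at hfub
  rw [intervalIntegral.integral_neg, integral_neg] at hfub
  exact neg_injective hfub
end

section
/- Continuous adjoint identity with an integer-order dispersion term (power-law exponent y = 3, no absorption): Let d ≥ 1, T > 0, and let ρ₀, c₀, η : ℝ^d → ℝ be smooth with ρ₀(r) > 0 and c₀(r) > 0 for all r. Let p₀ : ℝ^d → ℝ be smooth and compactly supported, and let w, h : ℝ^d × ℝ → ℝ be smooth and compactly supported. Suppose p, ρ : ℝ^d × ℝ → ℝ and u : ℝ^d × ℝ → ℝ^d are smooth, compactly supported in space uniformly for t ∈ [0,T], and satisfy ∂u/∂t(r,t) = −(1/ρ₀(r)) ∇p(r,t), ∂ρ/∂t(r,t) = −ρ₀(r) ∇·u(r,t), p(r,t) = c₀(r)² ( ρ(r,t) + η(r) Δρ(r,t) ), with p(r,0) = p₀(r) and u(r,0) = 0, where Δ denotes the spatial Laplacian.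 Suppose p*, ρ*, u* are smooth, compactly supported in space uniformly for t ∈ [0,T], and satisfy the adjoint system ∂u*/∂t(r,t) = −(1/ρ₀(r)) ∇p*(r,t), ∂ρ*/∂t(r,t) = ρ₀(r) ( −∇·u*(r,t) + w(r,T−t) h(r,T−t) ), p*(r,t) = c₀(r)² ρ*(r,t) + ρ₀(r) Δ( η(·) c₀(·)² ρ*(·,t)/ρ₀(·) )(r), with p*(r,0) = 0 and u*(r,0) = 0. Then ∫₀^T ∫_{ℝ^d} w(r,t) p(r,t) h(r,t) dr dt = ∫_{ℝ^d} p₀(r) ρ*(r,T)/ρ₀(r) dr. -/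
open MeasureTheory

/-- Spatial Laplacian of a scalar field on `ℝ^d`. -/
noncomputable def spaceLap {d : ℕ}
    (f : EuclideanSpace ℝ (Fin d) → ℝ)
    (r : EuclideanSpace ℝ (Fin d)) : ℝ :=
  spaceDiv (gradient f) r


section helpers

variable {d : ℕ}

local notation "𝔼" => EuclideanSpace ℝ (Fin d)

lemma aux_spaceDiv_continuous {v : 𝔼 → 𝔼} (hv : ContDiff ℝ (⊤ : ℕ∞) v) :
    Continuous (spaceDiv v) := by
  have h1 : Continuous (fderiv ℝ v) := hv.continuous_fderiv (by simp)
  unfold spaceDiv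
  fun_prop

lemma aux_gradient_contDiff {f : 𝔼 → ℝ} (hf : ContDiff ℝ (⊤ : ℕ∞) f) :
    ContDiff ℝ (⊤ : ℕ∞) (gradient f) := by
  have h1 : ContDiff ℝ (⊤ : ℕ∞) (fderiv ℝ f) := hf.fderiv_right (by simp)
  exact (InnerProductSpace.toDual ℝ 𝔼).symm.toContinuousLinearEquiv.contDiff.comp h1

lemma aux_fderiv_zero {f : 𝔼 → ℝ} {K : Set 𝔼} (hK : IsCompact K)
    (h0 : ∀ x ∉ K, f x = 0) (x : 𝔼) (hx : x ∉ K) : fderiv ℝ f x = 0 := by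
  have h : f =ᶠ[nhds x] fun _ => 0 := by
    filter_upwards [hK.isClosed.isOpen_compl.mem_nhds hx] with y hy using h0 y hy
  rw [h.fderiv_eq]
  simp

lemma aux_ibp {f : 𝔼 → ℝ} {v : 𝔼 → 𝔼} {K : Set 𝔼} (hK : IsCompact K)
    (hf : ContDiff ℝ (⊤ : ℕ∞) f) (hv : ContDiff ℝ (⊤ : ℕ∞) v) (h0 : ∀ x ∉ K, f x = 0) :
    ∫ x in K, f x * spaceDiv v x = - ∫ x in K, fderiv ℝ f x (v x) := by
  have hz := aux_fderiv_zero hK h0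
  rw [setIntegral_eq_integral_of_forall_compl_eq_zero (fun x hx => by simp [h0 x hx]),
    setIntegral_eq_integral_of_forall_compl_eq_zero (fun x hx => by simp [hz x hx])]
  have hfc : Continuous (fderiv ℝ f) := hf.continuous_fderiv (by simp)
  have hvc : Continuous (fderiv ℝ v) := hv.continuous_fderiv (by simp)
  have hfc0 := hf.continuous
  have hvc0 := hv.continuous
  have hvi : ∀ i x, fderiv ℝ (fun y => v y i) x = (EuclideanSpace.proj i).comp (fderiv ℝ v x) := by
    intro i x
    have := (hv.differentiable (by simp) x).hasFDerivAt
    exact ((EuclideanSpace.proj (𝕜 := ℝ) i).hasFDerivAt.comp x this).fderiv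
  have hexp : ∀ x, fderiv ℝ f x (v x)
      = ∑ i, fderiv ℝ f x (EuclideanSpace.single i 1) * v x i := by
    intro x
    have hvx : v x = ∑ i, v x i • EuclideanSpace.single i (1 : ℝ) := by
      ext j
      simp [Finset.sum_apply, Pi.single_apply]
    conv_lhs => rw [hvx]
    simp [map_sum, mul_comm]
  have I1 : ∀ i, Integrable (fun x => f x * fderiv ℝ (fun y => v y i) x
      (EuclideanSpace.single i 1)) := by
    intro i
    refine Continuous.integrable_of_hasCompactSupport ?_ ?_
    · simp only [hvi]
      fun_prop
    · exact HasCompactSupport.intro hK (fun x hx => by simp [h0 x hx])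
  have I2 : ∀ i, Integrable (fun x => fderiv ℝ f x (EuclideanSpace.single i 1) * v x i) := by
    intro i
    refine Continuous.integrable_of_hasCompactSupport (by fun_prop) ?_
    exact HasCompactSupport.intro hK (fun x hx => by simp [hz x hx])
  have I3 : ∀ i, Integrable (fun x => f x * v x i) := by
    intro i
    refine Continuous.integrable_of_hasCompactSupport (by fun_prop) ?_
    exact HasCompactSupport.intro hK (fun x hx => by simp [h0 x hx])
  have hdiv : ∀ x, f x * spaceDiv v x
      = ∑ i, f x * fderiv ℝ (fun y => v y i) x (EuclideanSpace.single i 1) := by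
    intro x
    simp [spaceDiv, hvi, Finset.mul_sum]
  simp only [hexp, hdiv]
  rw [integral_finsetSum _ (fun i _ => I1 i), integral_finsetSum _ (fun i _ => I2 i),
    ← Finset.sum_neg_distrib]
  refine Finset.sum_congr rfl fun i _ => ?_
  refine integral_mul_fderiv_eq_neg_fderiv_mul_of_integrable (I2 i) (I1 i) (I3 i) ?_ ?_
  · exact fun x _ => hf.differentiable (by simp) x
  · intro x _
    exact ((EuclideanSpace.proj (𝕜 := ℝ) i).differentiableAt.comp x
      (hv.differentiable (by simp) x))

lemma aux_lap_symm {f g : 𝔼 → ℝ} {K : Set 𝔼} (hK : IsCompact K)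
    (hf : ContDiff ℝ (⊤ : ℕ∞) f) (hg : ContDiff ℝ (⊤ : ℕ∞) g)
    (hf0 : ∀ x ∉ K, f x = 0) (hg0 : ∀ x ∉ K, g x = 0) :
    ∫ x in K, g x * spaceLap f x = ∫ x in K, f x * spaceLap g x := by
  unfold spaceLap
  rw [aux_ibp hK hg (aux_gradient_contDiff hf) hg0, aux_ibp hK hf (aux_gradient_contDiff hg) hf0]
  congr 2
  ext x
  rw [← inner_gradient_left, ← inner_gradient_left, real_inner_comm]

lemma aux_slice_t {F : Type*} [NormedAddCommGroup F] [NormedSpace ℝ F] {f : 𝔼 × ℝ → F}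
    (hf : ContDiff ℝ (⊤ : ℕ∞) f) (r : 𝔼) (t : ℝ) :
    HasDerivAt (fun s => f (r, s)) (fderiv ℝ f (r, t) (0, 1)) t := by
  have h1 := (hf.differentiable (by simp) (r, t)).hasFDerivAt
  have h2 : HasDerivAt (fun s : ℝ => (r, s)) ((0 : 𝔼), (1 : ℝ)) t :=
    (hasDerivAt_const t r).prodMk (hasDerivAt_id t)
  exact h1.comp_hasDerivAt t h2

lemma aux_slice_t' {F : Type*} [NormedAddCommGroup F] [NormedSpace ℝ F] {f : 𝔼 × ℝ → F}
    (hf : ContDiff ℝ (⊤ : ℕ∞) f) (r : 𝔼) (t : ℝ) :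
    HasDerivAt (fun s => f (r, s)) (deriv (fun s => f (r, s)) t) t :=
  (aux_slice_t hf r t).differentiableAt.hasDerivAt

lemma aux_deriv_cont {F : Type*} [NormedAddCommGroup F] [NormedSpace ℝ F] {f : 𝔼 × ℝ → F}
    (hf : ContDiff ℝ (⊤ : ℕ∞) f) :
    Continuous (fun z : 𝔼 × ℝ => deriv (fun s => f (z.1, s)) z.2) := by
  have : (fun z : 𝔼 × ℝ => deriv (fun s => f (z.1, s)) z.2)
      = fun z => fderiv ℝ f z (0, 1) := by
    ext z
    exact (aux_slice_t hf z.1 z.2).deriv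
  rw [this]
  have := hf.continuous_fderiv (by simp)
  fun_prop

lemma aux_param_cont {f : 𝔼 × ℝ → ℝ} (hf : Continuous f) {K : Set 𝔼} (hK : IsCompact K) :
    Continuous (fun t => ∫ r in K, f (r, t)) := by
  refine continuous_parametric_integral_of_continuous (f := fun t r => f (r, t)) ?_ hK
  exact hf.comp continuous_swap

lemma aux_param {f : 𝔼 × ℝ → ℝ} (hf : ContDiff ℝ (⊤ : ℕ∞) f) {K : Set 𝔼} (hK : IsCompact K)
    (t : ℝ) : HasDerivAt (fun t => ∫ r in K, f (r, t))
      (∫ r in K, deriv (fun s => f (r, s)) t) t := by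
  have hc := aux_deriv_cont hf
  have hfc := hf.continuous
  obtain ⟨M, hM⟩ := (hK.prod (isCompact_Icc (a := t - 1) (b := t + 1))).bddAbove_image
    hc.norm.continuousOn
  have hfin : IsFiniteMeasure (volume.restrict K) := ⟨by simpa using hK.measure_lt_top⟩
  refine (hasDerivAt_integral_of_dominated_loc_of_deriv_le (μ := volume.restrict K)
    (F := fun t r => f (r, t)) (F' := fun t r => deriv (fun s => f (r, s)) t)
    (s := Set.Icc (t - 1) (t + 1)) (bound := fun _ => M)
    (Icc_mem_nhds (by linarith) (by linarith)) ?_ ?_ ?_ ?_ ?_ ?_).2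
  · exact Filter.Eventually.of_forall fun s =>
      Continuous.aestronglyMeasurable (by fun_prop)
  · exact ContinuousOn.integrableOn_compact hK (by fun_prop)
  · exact (hc.comp (by fun_prop : Continuous fun r : 𝔼 => (r, t))).aestronglyMeasurable
  · refine (ae_restrict_iff' hK.measurableSet).2 (Filter.Eventually.of_forall ?_)
    intro r hr s hs
    exact hM ⟨(r, s), ⟨hr, hs⟩, rfl⟩
  · exact integrable_const M
  · exact Filter.Eventually.of_forall fun r s _ => aux_slice_t' hf r s

end helpers

/-- Continuous adjoint identity with an integer-order dispersion term (power-law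
exponent `y = 3`, no absorption): the forward state equation is `p = c₀²(ρ + ηΔρ)`,
and the adjoint state equation is `p* = c₀²ρ* + ρ₀ Δ(η c₀² ρ*/ρ₀)`; then
`∫₀^T ∫ w p h dr dt = ∫ p₀(r) ρ*(r,T)/ρ₀(r) dr`. -/
theorem adjoint_identity_dispersion
    (d : ℕ) (hd : 1 ≤ d) (T : ℝ) (hT : 0 < T)
    (ρ₀ c₀ η : EuclideanSpace ℝ (Fin d) → ℝ)
    (hρ₀ : ContDiff ℝ (⊤ : ℕ∞) ρ₀) (hc₀ : ContDiff ℝ (⊤ : ℕ∞) c₀) (hη : ContDiff ℝ (⊤ : ℕ∞) η)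
    (hρ₀pos : ∀ r, 0 < ρ₀ r) (hc₀pos : ∀ r, 0 < c₀ r)
    (p₀ : EuclideanSpace ℝ (Fin d) → ℝ)
    (hp₀ : ContDiff ℝ (⊤ : ℕ∞) p₀) (hp₀supp : HasCompactSupport p₀)
    (w h : EuclideanSpace ℝ (Fin d) × ℝ → ℝ)
    (hw : ContDiff ℝ (⊤ : ℕ∞) w) (hwsupp : HasCompactSupport w)
    (hh : ContDiff ℝ (⊤ : ℕ∞) h) (hhsupp : HasCompactSupport h)
    -- forward fields
    (p ρ : EuclideanSpace ℝ (Fin d) × ℝ → ℝ)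
    (u : EuclideanSpace ℝ (Fin d) × ℝ → EuclideanSpace ℝ (Fin d))
    (hp : ContDiff ℝ (⊤ : ℕ∞) p) (hρ : ContDiff ℝ (⊤ : ℕ∞) ρ) (hu : ContDiff ℝ (⊤ : ℕ∞) u)
    (hsupp : ∃ K : Set (EuclideanSpace ℝ (Fin d)), IsCompact K ∧
      ∀ t ∈ Set.Icc (0 : ℝ) T, ∀ r ∉ K, p (r, t) = 0 ∧ ρ (r, t) = 0 ∧ u (r, t) = 0)
    -- forward system
    (hmom : ∀ r t, deriv (fun s => u (r, s)) t
      = -(ρ₀ r)⁻¹ • gradient (fun x => p (x, t)) r)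
    (hmass : ∀ r t, deriv (fun s => ρ (r, s)) t
      = -(ρ₀ r) * spaceDiv (fun x => u (x, t)) r)
    (hstate : ∀ r t, p (r, t) = (c₀ r) ^ 2 * (ρ (r, t) + η r * spaceLap (fun x => ρ (x, t)) r))
    (hpinit : ∀ r, p (r, 0) = p₀ r) (huinit : ∀ r, u (r, 0) = 0)
    -- adjoint fields
    (pa ρa : EuclideanSpace ℝ (Fin d) × ℝ → ℝ)
    (ua : EuclideanSpace ℝ (Fin d) × ℝ → EuclideanSpace ℝ (Fin d))
    (hpa : ContDiff ℝ (⊤ : ℕ∞) pa) (hρa : ContDiff ℝ (⊤ : ℕ∞) ρa) (hua : ContDiff ℝ (⊤ : ℕ∞) ua)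
    (hsuppa : ∃ K : Set (EuclideanSpace ℝ (Fin d)), IsCompact K ∧
      ∀ t ∈ Set.Icc (0 : ℝ) T, ∀ r ∉ K, pa (r, t) = 0 ∧ ρa (r, t) = 0 ∧ ua (r, t) = 0)
    -- adjoint system
    (hmoma : ∀ r t, deriv (fun s => ua (r, s)) t
      = -(ρ₀ r)⁻¹ • gradient (fun x => pa (x, t)) r)
    (hmassa : ∀ r t, deriv (fun s => ρa (r, s)) t
      = ρ₀ r * (-(spaceDiv (fun x => ua (x, t)) r) + w (r, T - t) * h (r, T - t)))
    (hstatea : ∀ r t, pa (r, t) = (c₀ r) ^ 2 * ρa (r, t)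
      + ρ₀ r * spaceLap (fun x => η x * (c₀ x) ^ 2 * ρa (x, t) / ρ₀ x) r)
    (hpainit : ∀ r, pa (r, 0) = 0) (huainit : ∀ r, ua (r, 0) = 0) :
    ∫ t in (0 : ℝ)..T, ∫ r, w (r, t) * p (r, t) * h (r, t)
      = ∫ r, p₀ r * ρa (r, T) / ρ₀ r := by
  obtain ⟨K₁, hK₁, hsupp⟩ := hsupp
  obtain ⟨K₂, hK₂, hsuppa⟩ := hsuppa
  obtain ⟨K, hK, hs, hsa⟩ : ∃ K : Set (EuclideanSpace ℝ (Fin d)), IsCompact K ∧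
      (∀ t ∈ Set.Icc (0 : ℝ) T, ∀ r ∉ K, p (r, t) = 0 ∧ ρ (r, t) = 0 ∧ u (r, t) = 0) ∧
      (∀ t ∈ Set.Icc (0 : ℝ) T, ∀ r ∉ K, pa (r, t) = 0 ∧ ρa (r, t) = 0 ∧ ua (r, t) = 0) :=
    ⟨K₁ ∪ K₂, hK₁.union hK₂,
      fun t ht r hr => hsupp t ht r (fun h => hr (Or.inl h)),
      fun t ht r hr => hsuppa t ht r (fun h => hr (Or.inr h))⟩
  have hne : ∀ r, ρ₀ r ≠ 0 := fun r => (hρ₀pos r).ne'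
  have hpx : ∀ t, ContDiff ℝ (⊤ : ℕ∞) (fun x => p (x, t)) := fun t => by fun_prop
  have hρx : ∀ t, ContDiff ℝ (⊤ : ℕ∞) (fun x => ρ (x, t)) := fun t => by fun_prop
  have hux : ∀ t, ContDiff ℝ (⊤ : ℕ∞) (fun x => u (x, t)) := fun t => by fun_prop
  have hpax : ∀ t, ContDiff ℝ (⊤ : ℕ∞) (fun x => pa (x, t)) := fun t => by fun_prop
  have hρax : ∀ t, ContDiff ℝ (⊤ : ℕ∞) (fun x => ρa (x, t)) := fun t => by fun_prop
  have huax : ∀ t, ContDiff ℝ (⊤ : ℕ∞) (fun x => ua (x, t)) := fun t => by fun_prop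
  have hgx : ∀ t, ContDiff ℝ (⊤ : ℕ∞) (fun x => η x * (c₀ x) ^ 2 * ρa (x, t) / ρ₀ x) :=
    fun t => ContDiff.div (by fun_prop) hρ₀ hne
  have hLapc : ∀ {f : EuclideanSpace ℝ (Fin d) → ℝ}, ContDiff ℝ (⊤ : ℕ∞) f →
      Continuous (spaceLap f) := fun hf => aux_spaceDiv_continuous (aux_gradient_contDiff hf)
  have hInteg : ∀ {f : EuclideanSpace ℝ (Fin d) → ℝ}, Continuous f →
      Integrable f (volume.restrict K) :=
    fun hf => hf.continuousOn.integrableOn_compact hK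
  have hρ₀c := hρ₀.continuous
  have hc₀c := hc₀.continuous
  have hηc := hη.continuous
  have hpc := hp.continuous
  have hρc := hρ.continuous
  have huc := hu.continuous
  have hpac := hpa.continuous
  have hρac := hρa.continuous
  have huac := hua.continuous
  have hwc := hw.continuous
  have hhc := hh.continuous
  have hdual : ∀ t ∈ Set.Icc (0 : ℝ) T, ∀ s ∈ Set.Icc (0 : ℝ) T,
      ∫ r in K, p (r, t) * ρa (r, s) / ρ₀ r = ∫ r in K, ρ (r, t) * pa (r, s) / ρ₀ r := by
    intro t ht s hs'
    have h1 := aux_lap_symm hK (hρx t) (hgx s) (fun x hx => (hs t ht x hx).2.1)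
      (fun x hx => by simp [(hsa s hs' x hx).2.1])
    have e1 : ∀ r, p (r, t) * ρa (r, s) / ρ₀ r = c₀ r ^ 2 * ρ (r, t) * ρa (r, s) / ρ₀ r
        + η r * (c₀ r) ^ 2 * ρa (r, s) / ρ₀ r * spaceLap (fun x => ρ (x, t)) r := by
      intro r
      rw [hstate r t]
      ring
    have e2 : ∀ r, ρ (r, t) * pa (r, s) / ρ₀ r = c₀ r ^ 2 * ρ (r, t) * ρa (r, s) / ρ₀ r
        + ρ (r, t) * spaceLap (fun x => η x * (c₀ x) ^ 2 * ρa (x, s) / ρ₀ x) r := by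
      intro r
      rw [hstatea r s]
      have := hne r
      field_simp
    have hL1 := hLapc (hρx t)
    have hL2 := hLapc (hgx s)
    have hg2 := (hgx s).continuous
    have c1 : Continuous fun r => c₀ r ^ 2 * ρ (r, t) * ρa (r, s) / ρ₀ r :=
      Continuous.div (by fun_prop) hρ₀c hne
    simp only [e1, e2]
    have m2 : Continuous fun r => ρ (r, t)
        * spaceLap (fun x => η x * (c₀ x) ^ 2 * ρa (x, s) / ρ₀ x) r :=
      Continuous.mul (by fun_prop) hL2
    rw [integral_add, integral_add, h1]
    · exact hInteg c1
    · exact hInteg m2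
    · exact hInteg c1
    · exact hInteg (hg2.mul hL1)
  have hdual' : ∀ t ∈ Set.Ioo (0 : ℝ) T, ∀ s ∈ Set.Icc (0 : ℝ) T,
      ∫ r in K, deriv (fun τ => p (r, τ)) t * ρa (r, s) / ρ₀ r
        = ∫ r in K, deriv (fun τ => ρ (r, τ)) t * pa (r, s) / ρ₀ r := by
    intro t ht s hs'
    have d1 := aux_param (f := fun z => p z * ρa (z.1, s) / ρ₀ z.1)
      (ContDiff.div (by fun_prop) (by fun_prop) (fun z => hne z.1)) hK t
    have d2 := aux_param (f := fun z => ρ z * pa (z.1, s) / ρ₀ z.1)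
      (ContDiff.div (by fun_prop) (by fun_prop) (fun z => hne z.1)) hK t
    have e1 : ∀ r, deriv (fun τ => p (r, τ) * ρa (r, s) / ρ₀ r) t
        = deriv (fun τ => p (r, τ)) t * ρa (r, s) / ρ₀ r := fun r =>
      (((aux_slice_t' hp r t).mul_const _).div_const _).deriv
    have e2 : ∀ r, deriv (fun τ => ρ (r, τ) * pa (r, s) / ρ₀ r) t
        = deriv (fun τ => ρ (r, τ)) t * pa (r, s) / ρ₀ r := fun r =>
      (((aux_slice_t' hρ r t).mul_const _).div_const _).deriv
    simp only [e1, e2] at d1 d2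
    refine d1.unique (d2.congr_of_eventuallyEq ?_)
    filter_upwards [Ioo_mem_nhds ht.1 ht.2] with τ hτ
    exact hdual τ ⟨hτ.1.le, hτ.2.le⟩ s hs'
  let f : EuclideanSpace ℝ (Fin d) × ℝ → ℝ := fun z =>
    ρ₀ z.1 * inner ℝ (u z) (ua (z.1, T - z.2)) - p z * ρa (z.1, T - z.2) / ρ₀ z.1
  have hf : ContDiff ℝ (⊤ : ℕ∞) f := by
    refine ContDiff.sub ?_ (ContDiff.div (by fun_prop) (by fun_prop) (fun z => hne z.1))
    exact ContDiff.mul (by fun_prop) (ContDiff.inner ℝ hu (by fun_prop))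
  have hrev : ∀ {F : Type} [NormedAddCommGroup F] [NormedSpace ℝ F]
      {g : EuclideanSpace ℝ (Fin d) × ℝ → F}, ContDiff ℝ (⊤ : ℕ∞) g → ∀ r t,
      HasDerivAt (fun s => g (r, T - s)) (-(deriv (fun s => g (r, s)) (T - t))) t := by
    intro F _ _ g hg r t
    have h1 := aux_slice_t' hg r (T - t)
    have h2 : HasDerivAt (fun s : ℝ => T - s) (-1) t := by
      simpa using (hasDerivAt_id t).const_sub T
    simpa [Function.comp_def] using h1.scomp t h2
  have hfd : ∀ r t, deriv (fun s => f (r, s)) t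
      = (-(fderiv ℝ (fun x => p (x, t)) r (ua (r, T - t)))
        - p (r, t) * spaceDiv (fun x => ua (x, T - t)) r)
        + (fderiv ℝ (fun x => pa (x, T - t)) r (u (r, t))
          - deriv (fun τ => p (r, τ)) t * ρa (r, T - t) / ρ₀ r)
        + w (r, t) * p (r, t) * h (r, t) := by
    intro r t
    have D := (((aux_slice_t' hu r t).inner ℝ (hrev hua r t)).const_mul (ρ₀ r)).sub
      (((aux_slice_t' hp r t).mul (hrev hρa r t)).div_const (ρ₀ r))
    refine D.deriv.trans ?_
    rw [hmom, hmoma, hmassa]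
    simp only [inner_neg_right, inner_smul_left, inner_smul_right, inner_gradient_left,
      inner_gradient_right, neg_smul, inner_neg_left]
    have := hne r
    simp
    field_simp
    ring
  have key : ∀ t ∈ Set.Ioo (0 : ℝ) T, ∫ r in K, deriv (fun s => f (r, s)) t
      = ∫ r in K, w (r, t) * p (r, t) * h (r, t) := by
    intro t ht
    have ht' : t ∈ Set.Icc (0 : ℝ) T := ⟨ht.1.le, ht.2.le⟩
    have hTt : T - t ∈ Set.Icc (0 : ℝ) T := ⟨by linarith [ht.2], by linarith [ht.1]⟩
    have i1 := aux_ibp hK (hpx t) (huax (T - t)) (fun x hx => (hs t ht' x hx).1)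
    have i2 := aux_ibp hK (hpax (T - t)) (hux t) (fun x hx => (hsa _ hTt x hx).1)
    have i3 := hdual' t ht (T - t) hTt
    have e3 : ∀ r, deriv (fun τ => ρ (r, τ)) t * pa (r, T - t) / ρ₀ r
        = -(pa (r, T - t) * spaceDiv (fun x => u (x, t)) r) := by
      intro r
      rw [hmass]
      have := hne r
      field_simp
    simp only [e3] at i3
    rw [integral_neg, i2, neg_neg] at i3
    have q1 : Continuous (fderiv ℝ (fun x => p (x, t))) := (hpx t).continuous_fderiv (by simp)
    have q2 : Continuous (fderiv ℝ (fun x => pa (x, T - t))) :=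
      (hpax (T - t)).continuous_fderiv (by simp)
    have q3 := aux_spaceDiv_continuous (huax (T - t))
    have q4 : Continuous (fun r => deriv (fun τ => p (r, τ)) t) :=
      (aux_deriv_cont hp).comp (by fun_prop :
        Continuous fun r : EuclideanSpace ℝ (Fin d) => (r, t))
    have c1 : Continuous fun r => fderiv ℝ (fun x => p (x, t)) r (ua (r, T - t)) :=
      q1.clm_apply (by fun_prop)
    have c2 : Continuous fun r => p (r, t) * spaceDiv (fun x => ua (x, T - t)) r :=
      Continuous.mul (by fun_prop) q3
    have c3 : Continuous fun r => fderiv ℝ (fun x => pa (x, T - t)) r (u (r, t)) :=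
      q2.clm_apply (by fun_prop)
    have c4 : Continuous fun r => deriv (fun τ => p (r, τ)) t * ρa (r, T - t) / ρ₀ r :=
      Continuous.div (q4.mul (by fun_prop)) hρ₀c hne
    have c5 : Continuous fun r => w (r, t) * p (r, t) * h (r, t) := by fun_prop
    simp only [hfd]
    rw [integral_add, integral_add, integral_sub, integral_sub, integral_neg, i1, i3]
    · ring
    · exact hInteg c3
    · exact hInteg c4
    · exact hInteg c1.neg
    · exact hInteg c2
    · exact hInteg (c1.neg.sub c2)
    · exact hInteg (c3.sub c4)
    · exact hInteg ((c1.neg.sub c2).add (c3.sub c4))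
    · exact hInteg c5
  have hcontG : Continuous fun t => ∫ r in K, f (r, t) := aux_param_cont hf.continuous hK
  have hcontH : Continuous fun t => ∫ r in K, w (r, t) * p (r, t) * h (r, t) :=
    aux_param_cont (f := fun z => w z * p z * h z) (by fun_prop) hK
  have ftc := intervalIntegral.integral_eq_sub_of_hasDerivAt_of_le hT.le hcontG.continuousOn
    (fun t ht => by
      have := aux_param hf hK t
      rwa [key t ht] at this) (hcontH.intervalIntegrable 0 T)
  have h0 : (0 : ℝ) ∈ Set.Icc (0 : ℝ) T := ⟨le_rfl, hT.le⟩
  have hTm : T ∈ Set.Icc (0 : ℝ) T := ⟨hT.le, le_rfl⟩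
  have hend : ∫ r in K, f (r, T) = 0 := by
    have e : ∀ r, f (r, T) = -(p (r, T) * ρa (r, 0) / ρ₀ r) := by
      intro r
      simp [f, huainit]
    simp only [e]
    rw [integral_neg, hdual T hTm 0 h0]
    simp [hpainit]
  have hstart : ∫ r in K, f (r, 0) = - ∫ r, p₀ r * ρa (r, T) / ρ₀ r := by
    have e : ∀ r, f (r, 0) = -(p₀ r * ρa (r, T) / ρ₀ r) := by
      intro r
      simp [f, huinit, hpinit]
    simp only [e]
    rw [integral_neg, setIntegral_eq_integral_of_forall_compl_eq_zero]
    intro x hx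
    simp [(hsa T hTm x hx).2.1]
  rw [hend, hstart, sub_neg_eq_add, zero_add] at ftc
  rw [← ftc]
  refine intervalIntegral.integral_congr fun t ht => ?_
  rw [Set.uIcc_of_le hT.le] at ht
  refine (setIntegral_eq_integral_of_forall_compl_eq_zero fun x hx => ?_).symm
  simp [(hs t ht x hx).1]
end

section
/- Intermediate identity from the continuity and state equations (lossless case): Let d ≥ 1, T > 0, and let ρ₀, c₀ : ℝ^d → ℝ be smooth with ρ₀(r) > 0 and c₀(r) > 0 for all r. Let p₀ : ℝ^d → ℝ be smooth and compactly supported. Suppose p, ρ : ℝ^d × ℝ → ℝ and u : ℝ^d × ℝ → ℝ^d are smooth, compactly supported in space uniformly for t ∈ [0,T], and satisfy ∂ρ/∂t(r,t) = −ρ₀(r) ∇·u(r,t), p(r,t) = c₀(r)² ρ(r,t), and p(r,0) = p₀(r). Suppose p*, ρ* : ℝ^d × ℝ → ℝ are smooth, compactly supported in space uniformly for t ∈ [0,T], and satisfy p*(r,t) = c₀(r)² ρ*(r,t) and ρ*(r,0) = 0. Then ∫_{ℝ^d} p₀(r) ρ*(r,T)/ρ₀(r) dr = ∫₀^T ∫_{ℝ^d}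 [ (p(r,t)/ρ₀(r)) (∂ρ*/∂t)(r,T−t) − u(r,t) · ∇p*(r,T−t) ] dr dt. -/
open MeasureTheory

lemma aux_swap {d : ℕ} {T : ℝ} (hT : 0 < T) (F : EuclideanSpace ℝ (Fin d) × ℝ → ℝ)
    (hF : Continuous F) (K : Set (EuclideanSpace ℝ (Fin d))) (hK : IsCompact K)
    (h0 : ∀ t ∈ Set.Icc (0 : ℝ) T, ∀ r ∉ K, F (r, t) = 0) :
    ∫ t in (0 : ℝ)..T, ∫ r, F (r, t) = ∫ r, ∫ t in (0 : ℝ)..T, F (r, t) := by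
  apply intervalIntegral_integral_swap
  rw [Set.uIoc_of_le hT.le]
  have h1 : IntegrableOn (Function.uncurry fun (t : ℝ) (r : EuclideanSpace ℝ (Fin d)) => F (r, t))
      (Set.Icc 0 T ×ˢ K) := by
    apply ContinuousOn.integrableOn_compact (isCompact_Icc.prod hK)
    apply Continuous.continuousOn
    exact hF.comp (continuous_snd.prodMk continuous_fst)
  have h2 : IntegrableOn (Function.uncurry fun (t : ℝ) (r : EuclideanSpace ℝ (Fin d)) => F (r, t))
      (Set.Icc 0 T ×ˢ Set.univ) := by
    refine h1.of_forall_sdiff_eq_zero (measurableSet_Icc.prod MeasurableSet.univ) ?_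
    rintro ⟨t, r⟩ ⟨⟨ht, -⟩, h⟩
    exact h0 t ht r (fun hr => h ⟨ht, hr⟩)
  have h3 := h2.mono_set (Set.prod_mono (Set.Ioc_subset_Icc_self) (le_refl Set.univ))
  rw [IntegrableOn, Measure.volume_eq_prod, ← Measure.prod_restrict, Measure.restrict_univ] at h3
  exact h3

lemma aux_div_s3 {d : ℕ} (v : EuclideanSpace ℝ (Fin d) → EuclideanSpace ℝ (Fin d))
    (f : EuclideanSpace ℝ (Fin d) → ℝ) (hv : ContDiff ℝ 1 v) (hf : ContDiff ℝ 1 f)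
    (hs : HasCompactSupport v) :
    Integrable (fun r => spaceDiv v r * f r + @inner ℝ _ _ (v r) (gradient f r)) ∧
    ∫ r, (spaceDiv v r * f r + @inner ℝ _ _ (v r) (gradient f r)) = 0 := by
  have hvd : Differentiable ℝ v := hv.differentiable (by norm_num)
  have hfd : Differentiable ℝ f := hf.differentiable (by norm_num)
  have hvi : ∀ i, ContDiff ℝ 1 (fun r => v r i) := fun i => by fun_prop
  have hsi : ∀ i, HasCompactSupport (fun r => v r i) := fun i =>
    hs.comp_left (g := fun x : EuclideanSpace ℝ (Fin d) => x i) rfl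
  have hdi : ∀ i r (w : EuclideanSpace ℝ (Fin d)),
      fderiv ℝ (fun r => v r i) r w = fderiv ℝ v r w i := by
    intro i r w
    have := ((EuclideanSpace.proj i : EuclideanSpace ℝ (Fin d) →L[ℝ] ℝ).hasFDerivAt.comp r
      (hvd r).hasFDerivAt).fderiv
    have h2 : (fun r => v r i) = (EuclideanSpace.proj i : EuclideanSpace ℝ (Fin d) →L[ℝ] ℝ) ∘ v := rfl
    rw [h2, this]; rfl
  have hrep : ∀ r, spaceDiv v r * f r + @inner ℝ _ _ (v r) (gradient f r)
      = ∑ i, (fderiv ℝ (fun r => v r i) r (EuclideanSpace.single i 1) * f r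
        + v r i * fderiv ℝ f r (EuclideanSpace.single i 1)) := by
    intro r
    have e : v r = ∑ i, v r i • EuclideanSpace.single i (1 : ℝ) := by
      have := (EuclideanSpace.basisFun (Fin d) ℝ).sum_repr (v r)
      simpa using this.symm
    rw [inner_gradient_right, Finset.sum_add_distrib, ← Finset.sum_mul]
    congr 1
    · simp only [spaceDiv, hdi]
    · conv_lhs => rw [e]
      simp
  have I1 : ∀ i, Integrable (fun r => fderiv ℝ (fun r => v r i) r (EuclideanSpace.single i 1) * f r) := by
    intro i
    apply Continuous.integrable_of_hasCompactSupport
    · exact (((hvi i).continuous_fderiv (by norm_num)).clm_apply continuous_const).mul hf.continuous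
    · exact ((hsi i).fderiv_apply ℝ _).mul_right
  have I2 : ∀ i, Integrable (fun r => v r i * fderiv ℝ f r (EuclideanSpace.single i 1)) := by
    intro i
    apply Continuous.integrable_of_hasCompactSupport
    · exact (hvi i).continuous.mul ((hf.continuous_fderiv (by norm_num)).clm_apply continuous_const)
    · exact (hsi i).mul_right
  have I3 : ∀ i, Integrable (fun r => v r i * f r) := by
    intro i
    apply Continuous.integrable_of_hasCompactSupport
    · exact (hvi i).continuous.mul hf.continuous
    · exact (hsi i).mul_right
  simp only [hrep]
  refine ⟨integrable_finsetSum _ fun i _ => (I1 i).add (I2 i), ?_⟩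
  refine (integral_finsetSum _ fun i _ => (I1 i).add (I2 i)).trans ?_
  simp only [Pi.add_apply]
  apply Finset.sum_eq_zero
  intro i _
  rw [integral_add (I1 i) (I2 i), integral_mul_fderiv_eq_neg_fderiv_mul_of_integrable (I1 i) (I2 i)
    (I3 i) (fun x _ => ((hvi i).differentiable (by norm_num)) x) (fun x _ => hfd x)]
  ring

lemma aux_deriv {d : ℕ} (g : EuclideanSpace ℝ (Fin d) × ℝ → ℝ) (hg : ContDiff ℝ (⊤ : ℕ∞) g)
    (r : EuclideanSpace ℝ (Fin d)) (t : ℝ) :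
    HasDerivAt (fun s => g (r, s)) (fderiv ℝ g (r, t) (0, 1)) t := by
  have h1 : HasDerivAt (fun s : ℝ => (r, s)) ((0 : EuclideanSpace ℝ (Fin d)), (1 : ℝ)) t :=
    (hasDerivAt_const t r).prodMk (hasDerivAt_id t)
  exact ((hg.differentiable (by simp)) (r, t)).hasFDerivAt.comp_hasDerivAt t h1

/-- Intermediate identity from the continuity and state equations (lossless case):
`∫ p₀(r) ρ*(r,T)/ρ₀(r) dr
  = ∫₀^T ∫ [ (p(r,t)/ρ₀(r)) ∂ρ*/∂t(r,T−t) − u(r,t) · ∇p*(r,T−t) ] dr dt`. -/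
theorem intermediate_identity_continuity_state
    (d : ℕ) (hd : 1 ≤ d) (T : ℝ) (hT : 0 < T)
    (ρ₀ c₀ : EuclideanSpace ℝ (Fin d) → ℝ)
    (hρ₀ : ContDiff ℝ (⊤ : ℕ∞) ρ₀) (hc₀ : ContDiff ℝ (⊤ : ℕ∞) c₀)
    (hρ₀pos : ∀ r, 0 < ρ₀ r) (hc₀pos : ∀ r, 0 < c₀ r)
    (p₀ : EuclideanSpace ℝ (Fin d) → ℝ)
    (hp₀ : ContDiff ℝ (⊤ : ℕ∞) p₀) (hp₀supp : HasCompactSupport p₀)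
    -- forward fields
    (p ρ : EuclideanSpace ℝ (Fin d) × ℝ → ℝ)
    (u : EuclideanSpace ℝ (Fin d) × ℝ → EuclideanSpace ℝ (Fin d))
    (hp : ContDiff ℝ (⊤ : ℕ∞) p) (hρ : ContDiff ℝ (⊤ : ℕ∞) ρ) (hu : ContDiff ℝ (⊤ : ℕ∞) u)
    (hsupp : ∃ K : Set (EuclideanSpace ℝ (Fin d)), IsCompact K ∧
      ∀ t ∈ Set.Icc (0 : ℝ) T, ∀ r ∉ K, p (r, t) = 0 ∧ ρ (r, t) = 0 ∧ u (r, t) = 0)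
    (hmass : ∀ r t, deriv (fun s => ρ (r, s)) t
      = -(ρ₀ r) * spaceDiv (fun x => u (x, t)) r)
    (hstate : ∀ r t, p (r, t) = (c₀ r) ^ 2 * ρ (r, t))
    (hpinit : ∀ r, p (r, 0) = p₀ r)
    -- adjoint fields
    (pa ρa : EuclideanSpace ℝ (Fin d) × ℝ → ℝ)
    (hpa : ContDiff ℝ (⊤ : ℕ∞) pa) (hρa : ContDiff ℝ (⊤ : ℕ∞) ρa)
    (hsuppa : ∃ K : Set (EuclideanSpace ℝ (Fin d)), IsCompact K ∧
      ∀ t ∈ Set.Icc (0 : ℝ) T, ∀ r ∉ K, pa (r, t) = 0 ∧ ρa (r, t) = 0)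
    (hstatea : ∀ r t, pa (r, t) = (c₀ r) ^ 2 * ρa (r, t))
    (hρainit : ∀ r, ρa (r, 0) = 0) :
    ∫ r, p₀ r * ρa (r, T) / ρ₀ r
      = ∫ t in (0 : ℝ)..T, ∫ r,
          (p (r, t) / ρ₀ r * deriv (fun s => ρa (r, s)) (T - t)
            - @inner ℝ _ _ (u (r, t)) (gradient (fun x => pa (x, T - t)) r)) := by
  obtain ⟨K, hK, hK0⟩ := hsupp
  obtain ⟨K', hK', hK0'⟩ := hsuppa
  have hne : ∀ r, ρ₀ r ≠ 0 := fun r => (hρ₀pos r).ne'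
  set H : EuclideanSpace ℝ (Fin d) × ℝ → ℝ := fun z =>
    p z / ρ₀ z.1 * fderiv ℝ ρa (z.1, T - z.2) (0, 1)
      - fderiv ℝ p z (0, 1) * ρa (z.1, T - z.2) / ρ₀ z.1 with hH
  have hTt : ∀ t ∈ Set.Icc (0 : ℝ) T, T - t ∈ Set.Icc (0 : ℝ) T := by
    intro t ht
    exact ⟨by linarith [ht.2], by linarith [ht.1]⟩
  have hHc : Continuous H := by
    have c1 := hρa.continuous_fderiv (by simp)
    have c2 := hp.continuous_fderiv (by simp)
    have c3 := hρa.continuous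
    have c4 := hp.continuous
    have c5 := hρ₀.continuous
    have m : Continuous (fun z : EuclideanSpace ℝ (Fin d) × ℝ => (z.1, T - z.2)) := by fun_prop
    have n1 : Continuous (fun z : EuclideanSpace ℝ (Fin d) × ℝ => ρ₀ z.1) := c5.comp continuous_fst
    exact ((c4.div n1 fun z => hne _).mul ((c1.comp m).clm_apply continuous_const)).sub
      (((c2.clm_apply continuous_const).mul (c3.comp m)).div n1 fun z => hne _)
  have hH0 : ∀ t ∈ Set.Icc (0 : ℝ) T, ∀ r ∉ K ∪ K', H (r, t) = 0 := by
    intro t ht r hr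
    simp only [Set.mem_union, not_or] at hr
    simp [hH, (hK0 t ht r hr.1).1, (hK0' _ (hTt t ht) r hr.2).2]
  have hder : ∀ r t, HasDerivAt (fun s => -(p (r, s) * ρa (r, T - s) / ρ₀ r)) (H (r, t)) t := by
    intro r t
    have h1 := aux_deriv p hp r t
    have h2 := (aux_deriv ρa hρa r (T - t)).comp t ((hasDerivAt_id t).const_sub T)
    have h3 := ((h1.mul h2).div_const (ρ₀ r)).neg
    refine h3.congr_deriv ?_
    simp only [hH, Function.comp, id]
    ring
  have hftc : ∀ r, ∫ t in (0 : ℝ)..T, H (r, t) = p₀ r * ρa (r, T) / ρ₀ r := by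
    intro r
    rw [intervalIntegral.integral_eq_sub_of_hasDerivAt (fun t _ => hder r t)
      ((hHc.comp (by fun_prop : Continuous fun t : ℝ => (r, t))).intervalIntegrable _ _)]
    simp [hρainit, hpinit]
  rw [← integral_congr_ae (Filter.Eventually.of_forall hftc),
    ← aux_swap hT H hHc _ (hK.union hK') hH0]
  apply intervalIntegral.integral_congr
  intro t ht
  rw [Set.uIcc_of_le hT.le] at ht
  have hu1 : ContDiff ℝ 1 (fun x => u (x, t)) :=
    (hu.of_le (by exact_mod_cast le_top)).comp (contDiff_id.prodMk contDiff_const)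
  have hpa1 : ContDiff ℝ 1 (fun x => pa (x, T - t)) :=
    (hpa.of_le (by exact_mod_cast le_top)).comp (contDiff_id.prodMk contDiff_const)
  have hus : HasCompactSupport (fun x => u (x, t)) :=
    HasCompactSupport.intro hK fun r hr => (hK0 t ht r hr).2.2
  obtain ⟨J1, J2⟩ := aux_div_s3 _ _ hu1 hpa1 hus
  have J3 : Integrable (fun r => H (r, t)) :=
    (hHc.comp (by fun_prop : Continuous fun r : EuclideanSpace ℝ (Fin d) =>
      (r, t))).integrable_of_hasCompactSupport
      (HasCompactSupport.intro (hK.union hK') fun r hr => hH0 t ht r hr)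
  have key : ∀ r, p (r, t) / ρ₀ r * deriv (fun s => ρa (r, s)) (T - t)
            - @inner ℝ _ _ (u (r, t)) (gradient (fun x => pa (x, T - t)) r)
      = H (r, t) - (spaceDiv (fun x => u (x, t)) r * pa (r, T - t)
        + @inner ℝ _ _ (u (r, t)) (gradient (fun x => pa (x, T - t)) r)) := by
    intro r
    have e1 : fderiv ℝ p (r, t) (0, 1) = c₀ r ^ 2 * (-(ρ₀ r) * spaceDiv (fun x => u (x, t)) r) := by
      rw [← hmass, ← (aux_deriv p hp r t).deriv, (aux_deriv ρ hρ r t).deriv]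
      have := (aux_deriv ρ hρ r t).const_mul (c₀ r ^ 2)
      simp only [hstate]
      exact this.deriv
    have hn := hne r
    simp only [hH]
    rw [e1, (aux_deriv ρa hρa r (T - t)).deriv, hstatea]
    field_simp
    ring
  simp only [key]
  rw [integral_sub J3 J1, J2, sub_zero]
end

section
/- Intermediate identity from the equation of motion: Let d ≥ 1, T > 0, and let ρ₀ : ℝ^d → ℝ be smooth with ρ₀(r) > 0 for all r. Suppose p : ℝ^d × ℝ → ℝ and u : ℝ^d × ℝ → ℝ^d are smooth, compactly supported in space uniformly for t ∈ [0,T], and satisfy the equation of motion ∂u/∂t(r,t) = −(1/ρ₀(r)) ∇p(r,t) with u(r,0) = 0. Suppose p* : ℝ^d × ℝ → ℝ and u* : ℝ^d × ℝ → ℝ^d are smooth, compactly supported in space uniformly for t ∈ [0,T], with u*(r,0) = 0. Then ∫₀^T ∫_{ℝ^d} [ ρ₀(r) u(r,t) · (∂u*/∂t)(r,T−t) − p(r,t) ∇·u*(r,T−t) ] dr dt = 0. -/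
open MeasureTheory

lemma aux_div_s4 {d : ℕ} (q : EuclideanSpace ℝ (Fin d) → ℝ)
    (v : EuclideanSpace ℝ (Fin d) → EuclideanSpace ℝ (Fin d))
    (hq : ContDiff ℝ 1 q) (hv : ContDiff ℝ 1 v) (hc : HasCompactSupport q) :
    ∫ r, q r * spaceDiv v r = - ∫ r, fderiv ℝ q r (v r) := by
  have hqc := hq.continuous
  have hvc := hv.continuous
  have hq' : Continuous (fderiv ℝ q) := hq.continuous_fderiv (by norm_num)
  have hv' : Continuous (fderiv ℝ v) := hv.continuous_fderiv (by norm_num)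
  have hvi : ∀ i x w, fderiv ℝ (fun y => v y i) x w = fderiv ℝ v x w i := by
    intro i x w
    have h1 : HasFDerivAt (fun y => v y i)
        ((EuclideanSpace.proj i : EuclideanSpace ℝ (Fin d) →L[ℝ] ℝ).comp (fderiv ℝ v x)) x :=
      (EuclideanSpace.proj i : EuclideanSpace ℝ (Fin d) →L[ℝ] ℝ).hasFDerivAt.comp x
        (hv.differentiable (by norm_num) x).hasFDerivAt
    rw [h1.fderiv]
    rfl
  have hvci : ∀ i, Continuous (fun x => v x i) := fun i => by fun_prop
  have hvci' : ∀ i, Continuous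
      (fun x => fderiv ℝ v x (EuclideanSpace.single i 1) i) := fun i => by fun_prop
  have hqi' : ∀ i : Fin d, Continuous
      (fun x => fderiv ℝ q x (EuclideanSpace.single i 1)) := fun i => by fun_prop
  have I1 : ∀ i, Integrable (fun x => q x * fderiv ℝ v x (EuclideanSpace.single i 1) i) :=
    fun i => (hqc.mul (hvci' i)).integrable_of_hasCompactSupport hc.mul_right
  have I2 : ∀ i, Integrable (fun x => fderiv ℝ q x (EuclideanSpace.single i 1) * v x i) :=
    fun i => ((hqi' i).mul (hvci i)).integrable_of_hasCompactSupport
      (HasCompactSupport.mul_right (hc.fderiv_apply ℝ _))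
  have I3 : ∀ i, Integrable (fun x => q x * v x i) :=
    fun i => (hqc.mul (hvci i)).integrable_of_hasCompactSupport hc.mul_right
  have key : ∀ i, ∫ x, q x * fderiv ℝ v x (EuclideanSpace.single i 1) i
      = - ∫ x, fderiv ℝ q x (EuclideanSpace.single i 1) * v x i := by
    intro i
    have := integral_mul_fderiv_eq_neg_fderiv_mul_of_integrable (μ := volume) (f := q)
      (g := fun y => v y i) (v := EuclideanSpace.single i 1) (I2 i)
      (by simpa only [hvi] using I1 i) (I3 i)
      (fun x _ => hq.differentiable (by norm_num) x)
      (fun x _ => ((EuclideanSpace.proj i : EuclideanSpace ℝ (Fin d) →L[ℝ] ℝ).differentiableAt.comp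
        x (hv.differentiable (by norm_num) x)))
    simpa only [hvi] using this
  have e : ∀ r, fderiv ℝ q r (v r)
      = ∑ i, fderiv ℝ q r (EuclideanSpace.single i 1) * v r i := by
    intro r
    have h : v r = ∑ i, v r i • EuclideanSpace.single i (1 : ℝ) := by
      ext j
      simp [Pi.single_apply]
    conv_lhs => rw [h]
    rw [map_sum]
    exact Finset.sum_congr rfl fun i _ => by rw [map_smul, smul_eq_mul, mul_comm]
  simp only [spaceDiv, e, Finset.mul_sum]
  rw [integral_finsetSum _ (fun i _ => I1 i), integral_finsetSum _ (fun i _ => I2 i),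
    ← Finset.sum_neg_distrib]
  exact Finset.sum_congr rfl fun i _ => key i

lemma aux_time {d : ℕ} (u : EuclideanSpace ℝ (Fin d) × ℝ → EuclideanSpace ℝ (Fin d))
    (hu : ContDiff ℝ (⊤ : ℕ∞) u) (r : EuclideanSpace ℝ (Fin d)) (t : ℝ) :
    HasDerivAt (fun s => u (r, s)) (fderiv ℝ u (r, t) (0, 1)) t := by
  have h1 : HasFDerivAt u (fderiv ℝ u (r, t)) (r, t) :=
    (hu.differentiable (by simp) (r, t)).hasFDerivAt
  exact h1.comp_hasDerivAt t ((hasDerivAt_const t r).prodMk (hasDerivAt_id t))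

/-- Intermediate identity from the equation of motion: pairing
`∂u/∂t = −(1/ρ₀)∇p` (with `u(·,0) = 0`) against the time-reversed adjoint velocity
`u*(r,T−t)` (with `u*(·,0) = 0`) and integrating by parts gives
`∫₀^T ∫ [ ρ₀ u · ∂u*/∂t(r,T−t) − p ∇·u*(r,T−t) ] dr dt = 0`. -/
theorem intermediate_identity_motion
    (d : ℕ) (hd : 1 ≤ d) (T : ℝ) (hT : 0 < T)
    (ρ₀ : EuclideanSpace ℝ (Fin d) → ℝ)
    (hρ₀ : ContDiff ℝ (⊤ : ℕ∞) ρ₀) (hρ₀pos : ∀ r, 0 < ρ₀ r)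
    -- forward fields
    (p : EuclideanSpace ℝ (Fin d) × ℝ → ℝ)
    (u : EuclideanSpace ℝ (Fin d) × ℝ → EuclideanSpace ℝ (Fin d))
    (hp : ContDiff ℝ (⊤ : ℕ∞) p) (hu : ContDiff ℝ (⊤ : ℕ∞) u)
    (hsupp : ∃ K : Set (EuclideanSpace ℝ (Fin d)), IsCompact K ∧
      ∀ t ∈ Set.Icc (0 : ℝ) T, ∀ r ∉ K, p (r, t) = 0 ∧ u (r, t) = 0)
    (hmom : ∀ r t, deriv (fun s => u (r, s)) t
      = -(ρ₀ r)⁻¹ • gradient (fun x => p (x, t)) r)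
    (huinit : ∀ r, u (r, 0) = 0)
    -- adjoint fields
    (pa : EuclideanSpace ℝ (Fin d) × ℝ → ℝ)
    (ua : EuclideanSpace ℝ (Fin d) × ℝ → EuclideanSpace ℝ (Fin d))
    (hpa : ContDiff ℝ (⊤ : ℕ∞) pa) (hua : ContDiff ℝ (⊤ : ℕ∞) ua)
    (hsuppa : ∃ K : Set (EuclideanSpace ℝ (Fin d)), IsCompact K ∧
      ∀ t ∈ Set.Icc (0 : ℝ) T, ∀ r ∉ K, pa (r, t) = 0 ∧ ua (r, t) = 0)
    (huainit : ∀ r, ua (r, 0) = 0) :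
    ∫ t in (0 : ℝ)..T, ∫ r,
        (ρ₀ r * @inner ℝ _ _ (u (r, t)) (deriv (fun s => ua (r, s)) (T - t))
          - p (r, t) * spaceDiv (fun x => ua (x, T - t)) r) = 0 := by
  obtain ⟨K, hK, hKu⟩ := hsupp
  obtain ⟨L, hL, hLu⟩ := hsuppa
  have hρc := hρ₀.continuous
  have huc := hu.continuous
  have huac := hua.continuous
  have hu' : Continuous (fderiv ℝ u) := hu.continuous_fderiv (by simp)
  have hua' : Continuous (fderiv ℝ ua) := hua.continuous_fderiv (by simp)
  let H : ℝ → EuclideanSpace ℝ (Fin d) → ℝ := fun t r =>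
    ρ₀ r * @inner ℝ _ _ (u (r, t)) (fderiv ℝ ua (r, T - t) (0, 1))
      - ρ₀ r * @inner ℝ _ _ (fderiv ℝ u (r, t) (0, 1)) (ua (r, T - t))
  have hHc : Continuous (Function.uncurry H) := by
    simp only [H, Function.uncurry_def]
    fun_prop
  have hH0 : ∀ t ∈ Set.Icc (0 : ℝ) T, ∀ r ∉ K ∪ L, H t r = 0 := by
    intro t ht r hr
    have ht' : T - t ∈ Set.Icc (0 : ℝ) T := ⟨by linarith [ht.2], by linarith [ht.1]⟩
    simp only [Set.mem_union, not_or] at hr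
    simp [H, (hKu t ht r hr.1).2, (hLu _ ht' r hr.2).2]
  have step : ∀ t ∈ Set.Icc (0 : ℝ) T,
      ∫ r, (ρ₀ r * @inner ℝ _ _ (u (r, t)) (deriv (fun s => ua (r, s)) (T - t))
          - p (r, t) * spaceDiv (fun x => ua (x, T - t)) r) = ∫ r in K ∪ L, H t r := by
    intro t ht
    have hq : ContDiff ℝ 1 (fun x => p (x, t)) :=
      (hp.of_le (by exact_mod_cast le_top)).comp (contDiff_id.prodMk contDiff_const)
    have hv : ContDiff ℝ 1 (fun x => ua (x, T - t)) :=
      (hua.of_le (by exact_mod_cast le_top)).comp (contDiff_id.prodMk contDiff_const)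
    have hqs : HasCompactSupport (fun x => p (x, t)) :=
      HasCompactSupport.intro hK fun r hr => (hKu t ht r hr).1
    have hq' : Continuous (fderiv ℝ (fun x => p (x, t))) := hq.continuous_fderiv (by norm_num)
    have hv' : Continuous (fderiv ℝ (fun x => ua (x, T - t))) :=
      hv.continuous_fderiv (by norm_num)
    have hvc := hv.continuous
    have hqc := hq.continuous
    have hsd : Continuous (spaceDiv (fun x => ua (x, T - t))) := by
      unfold spaceDiv
      fun_prop
    have hint1 : Integrable (fun r => ρ₀ r * @inner ℝ _ _ (u (r, t))
        (fderiv ℝ ua (r, T - t) (0, 1))) := by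
      refine Continuous.integrable_of_hasCompactSupport (by fun_prop) ?_
      exact HasCompactSupport.intro hK fun r hr => by simp [(hKu t ht r hr).2]
    have hint2 : Integrable (fun r => p (r, t) * spaceDiv (fun x => ua (x, T - t)) r) :=
      (hqc.mul hsd).integrable_of_hasCompactSupport hqs.mul_right
    have hint3 : Integrable (fun r => fderiv ℝ (fun x => p (x, t)) r (ua (r, T - t))) := by
      refine Continuous.integrable_of_hasCompactSupport (hq'.clm_apply hvc) ?_
      refine HasCompactSupport.intro (hqs.fderiv ℝ).isCompact fun r hr => ?_
      rw [image_eq_zero_of_notMem_tsupport hr]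
      rfl
    rw [setIntegral_eq_integral_of_forall_compl_eq_zero (hH0 t ht)]
    simp only [(aux_time ua hua _ _).deriv]
    rw [integral_sub hint1 hint2, aux_div_s4 _ _ hq hv hqs, sub_neg_eq_add,
      ← integral_add hint1 hint3]
    refine integral_congr_ae (Filter.Eventually.of_forall fun r => ?_)
    simp only [H]
    rw [← (aux_time u hu r t).deriv, hmom, inner_smul_left]
    have hg : @inner ℝ _ _ (gradient (fun x => p (x, t)) r) (ua (r, T - t))
        = fderiv ℝ (fun x => p (x, t)) r (ua (r, T - t)) := by
      rw [← InnerProductSpace.toDual_apply_apply, toDual_gradient]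
    rw [hg]
    have := (hρ₀pos r).ne'
    simp only [map_neg, map_inv₀, conj_trivial]
    field_simp
    ring
  rw [intervalIntegral.integral_congr (g := fun t => ∫ r in K ∪ L, H t r)
    (fun t ht => step t (by rwa [Set.uIcc_of_le hT.le] at ht))]
  rw [intervalIntegral_integral_swap]
  · have hz : ∀ r, ∫ t in (0 : ℝ)..T, H t r = 0 := by
      intro r
      have hd : ∀ t ∈ Set.uIcc (0 : ℝ) T, HasDerivAt
          (fun s => -(ρ₀ r * @inner ℝ _ _ (u (r, s)) (ua (r, T - s)))) (H t r) t := by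
        intro t _
        have h1 := aux_time u hu r t
        have h2 : HasDerivAt (fun s => ua (r, T - s)) (-(fderiv ℝ ua (r, T - t) (0, 1))) t := by
          have h3 := (aux_time ua hua r (T - t)).scomp t ((hasDerivAt_id t).const_sub T)
          rw [neg_one_smul] at h3
          exact h3
        have h4 := ((h1.inner ℝ h2).const_mul (ρ₀ r)).neg
        have h5 : H t r = -(ρ₀ r * (@inner ℝ _ _ (u (r, t)) (-(fderiv ℝ ua (r, T - t) (0, 1)))
            + @inner ℝ _ _ (fderiv ℝ u (r, t) (0, 1)) (ua (r, T - t)))) := by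
          simp only [H, inner_neg_right]
          ring
        rw [h5]
        exact h4
      rw [intervalIntegral.integral_eq_sub_of_hasDerivAt hd]
      · simp [huinit, huainit]
      · exact (hHc.comp (by fun_prop : Continuous fun t : ℝ => (t, r))).intervalIntegrable _ _
    simp [hz]
  · rw [Measure.prod_restrict]
    refine IntegrableOn.mono_set (t := Set.Icc 0 T ×ˢ (K ∪ L)) ?_ ?_
    · exact hHc.continuousOn.integrableOn_compact (isCompact_Icc.prod (hK.union hL))
    · rw [Set.uIoc_of_le hT.le]
      exact Set.prod_mono Set.Ioc_subset_Icc_self le_rfl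
end
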